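/- Let r ≥ 2 and let n₁ ≥ n₂ ≥ … ≥ n_r ≥ 1 with n = n₁ + n₂ + … + n_r, and let α be the number of indices i with n_i odd. Then the isometric path number of the complete r-partite graph K_{n₁,n₂,…,n_r} equals: ⌈n₁/2⌉ if 3·n₁ > 2·n; ⌈(n+α)/4⌉ if 3·α > n; and ⌈n/3⌉ if 3·α ≤ n and 3·n₁ ≤ 2·n. -/

import Mathlib

open SimpleGraph

/-- A walk is an *isometric path* if it is a path whose length equals the
distance in `G` between its two endpoints (i.e. a shortest path). -/
def SimpleGraph.Walk.IsIsometricPath {V : Type*} {G : SimpleGraph V} {u v : V}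
    (p : G.Walk u v) : Prop :=
  p.IsPath ∧ p.length = G.dist u v

/-- The *isometric path number* of `G`: the minimum number of isometric paths
needed to cover all vertices of `G`. -/
noncomputable def isometricPathNumber {V : Type*} (G : SimpleGraph V) : ℕ :=
  sInf {k | ∃ (u v : Fin k → V) (p : ∀ i, G.Walk (u i) (v i)),
    (∀ i, (p i).IsIsometricPath) ∧ ∀ w : V, ∃ i, w ∈ (p i).support}

open Finset in
/-- A discrete intermediate value property for sums of integers in prescribed intervals. -/
lemma Finset.exists_sum_eq_of_sum_le_of_le_sum {ι : Type*} (s : Finset ι) (lo hi : ι → ℕ)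
    (hle : ∀ i, lo i ≤ hi i) (T : ℕ) (hlo : ∑ i ∈ s, lo i ≤ T) (hhi : T ≤ ∑ i ∈ s, hi i) :
    ∃ f : ι → ℕ, (∀ i, lo i ≤ f i ∧ f i ≤ hi i) ∧ ∑ i ∈ s, f i = T := by
  classical
  induction T, hlo using Nat.le_induction with
  | base => exact ⟨lo, fun i => ⟨le_rfl, hle i⟩, rfl⟩
  | succ T _ ih =>
    obtain ⟨f, hf, hsum⟩ := ih (by omega)
    obtain ⟨i, hi, hlt⟩ : ∃ i ∈ s, f i < hi i := by
      refine exists_lt_of_sum_lt ?_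
      omega
    refine ⟨f + Pi.single i 1, fun j => ?_, ?_⟩
    · have := hf j
      by_cases hj : j = i
      · subst hj
        simp only [Pi.add_apply, Pi.single_eq_same]
        omega
      · simpa [hj] using this
    · simp [sum_add_distrib, hsum, hi]

namespace SimpleGraph

variable {ι : Type*} {V : ι → Type*}

lemma completeMultipartiteGraph_dist_le_one {u v : Σ i, V i} (h : u.1 ≠ v.1) :
    (completeMultipartiteGraph V).dist u v ≤ 1 :=
  have hadj : (completeMultipartiteGraph V).Adj u v := h
  dist_le hadj.toWalk

lemma completeMultipartiteGraph_dist_le_two [Nontrivial ι] [∀ i, Nonempty (V i)]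
    (u v : Σ i, V i) : (completeMultipartiteGraph V).dist u v ≤ 2 := by
  by_cases h : u.1 = v.1
  · obtain ⟨j, hj⟩ := exists_ne u.1
    have h₁ : (completeMultipartiteGraph V).Adj u ⟨j, Classical.arbitrary _⟩ := hj.symm
    have h₂ : (completeMultipartiteGraph V).Adj ⟨j, Classical.arbitrary _⟩ v := fun e => hj (e.trans h.symm)
    exact dist_le (.cons h₁ (.cons h₂ .nil))
  · exact (completeMultipartiteGraph_dist_le_one h).trans one_le_two

/-- An isometric path of a complete multipartite graph has at most two vertices in one part and
at most one further vertex, in another part. -/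
lemma Walk.IsIsometricPath.exists_support_subset [Nontrivial ι] [∀ i, Nonempty (V i)]
    {u v : Σ i, V i} {p : (completeMultipartiteGraph V).Walk u v} (hp : p.IsIsometricPath) :
    ∃ x y z : Σ i, V i, x.1 = y.1 ∧ x.1 ≠ z.1 ∧ ∀ w ∈ p.support, w = x ∨ w = y ∨ w = z := by
  have hlen := hp.2
  have hdist := completeMultipartiteGraph_dist_le_two u v
  match p with
  | .nil =>
    obtain ⟨j, hj⟩ := exists_ne u.1
    exact ⟨u, u, ⟨j, Classical.arbitrary _⟩, rfl, hj.symm, by simp⟩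
  | .cons h .nil => exact ⟨u, u, v, rfl, h, by simp⟩
  | .cons (v := m) h (.cons h' .nil) =>
    refine ⟨u, v, m, ?_, h, by simp +contextual [or_comm]⟩
    by_contra huv
    have := completeMultipartiteGraph_dist_le_one huv
    simp only [Walk.length_cons, Walk.length_nil] at hlen
    omega
  | .cons _ (.cons _ (.cons _ q)) =>
    simp only [Walk.length_cons] at hlen
    omega

lemma exists_isIsometricPath_of_completeMultipartiteGraph {x y z : Σ i, V i} (hxy : x.1 = y.1)
    (hxz : x.1 ≠ z.1) : ∃ (u v : Σ i, V i) (p : (completeMultipartiteGraph V).Walk u v),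
      p.IsIsometricPath ∧ x ∈ p.support ∧ y ∈ p.support ∧ z ∈ p.support := by
  have hadj : (completeMultipartiteGraph V).Adj x z := hxz
  have hadj' : (completeMultipartiteGraph V).Adj z y := fun h => hxz (hxy.trans h.symm)
  by_cases h : x = y
  · subst h
    refine ⟨x, z, hadj.toWalk, ⟨?_, ?_⟩, ?_⟩
    · simp [hadj.ne]
    · simp [dist_eq_one_iff_adj.2 hadj]
    · simp
  · let p : (completeMultipartiteGraph V).Walk x y := .cons hadj (.cons hadj' .nil)
    refine ⟨x, y, p, ⟨?_, ?_⟩, ?_⟩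
    · simp [p, h, hadj.ne, hadj'.ne]
    · refine le_antisymm ?_ (dist_le p)
      have h0 : (completeMultipartiteGraph V).dist x y ≠ 0 := fun h0 =>
        h (p.reachable.dist_eq_zero_iff.1 h0)
      have h1 : (completeMultipartiteGraph V).dist x y ≠ 1 := fun h1 =>
        (dist_eq_one_iff_adj.1 h1 : x.1 ≠ y.1) hxy
      simp only [p, Walk.length_cons, Walk.length_nil]
      omega
    · simp [p]

end SimpleGraph

/-- Two families of coloured tokens of equal size can be matched so that matched tokens have
different colours, provided no colour occurs too often. -/
lemma exists_bijective_sigma_fst_ne {ι : Type*} [Fintype ι] {x y : ι → ℕ} {k : ℕ}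
    (hx : ∑ i, x i = k) (hy : ∑ i, y i = k) (hxy : ∀ i, x i + y i ≤ k) :
    ∃ σ : (Σ i, Fin (x i)) → (Σ i, Fin (y i)), σ.Bijective ∧ ∀ a, a.1 ≠ (σ a).1 := by
  classical
  have hcx : Fintype.card (Σ i, Fin (x i)) = k := by simp [hx]
  have hcy : Fintype.card (Σ i, Fin (y i)) = k := by simp [hy]
  let t : (Σ i, Fin (x i)) → Finset (Σ i, Fin (y i)) := fun a =>
    Finset.univ.filter fun b => a.1 ≠ b.1
  obtain ⟨σ, hσ, hne⟩ := (Finset.all_card_le_biUnion_card_iff_exists_injective t).1 fun S => by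
    by_cases hS : ∃ a ∈ S, ∃ a' ∈ S, a.1 ≠ a'.1
    · obtain ⟨a, ha, a', ha', haa⟩ := hS
      have : S.biUnion t = Finset.univ := by
        ext b
        simp only [Finset.mem_biUnion, Finset.mem_univ, iff_true, t, Finset.mem_filter, true_and]
        by_cases hb : a.1 = b.1
        · exact ⟨a', ha', fun h => haa (hb.trans h.symm)⟩
        · exact ⟨a, ha, hb⟩
      rw [this, Finset.card_univ, hcy, ← hcx]
      exact Finset.card_le_univ S
    · push Not at hS
      obtain rfl | ⟨a, ha⟩ := S.eq_empty_or_nonempty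
      · simp
      have h₁ : S ⊆ Finset.univ.map (Function.Embedding.sigmaMk a.1) := by
        rintro ⟨i, s⟩ hb
        obtain rfl : a.1 = i := hS _ ha _ hb
        simp
      have h₂ : (t a)ᶜ ⊆ Finset.univ.map (Function.Embedding.sigmaMk a.1) := by
        rintro ⟨i, s⟩ hb
        obtain rfl : a.1 = i := by simpa [t] using hb
        simp
      have h₃ := Finset.card_le_card h₁
      have h₄ := Finset.card_le_card h₂
      have h₅ := Finset.card_le_card (Finset.subset_biUnion_of_mem t ha)
      have h₆ := hxy a.1
      rw [Finset.card_compl, hcy] at h₄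
      simp only [Finset.card_map, Finset.card_univ, Fintype.card_fin] at h₃ h₄
      omega
  refine ⟨σ, (Fintype.bijective_iff_injective_and_card σ).2 ⟨hσ, hcx.trans hcy.symm⟩, fun a => ?_⟩
  simpa [t] using hne a

section Cover

variable {ι : Type*} [Fintype ι] {n : ι → ℕ} {k : ℕ}

open SimpleGraph

/-- Isometric paths covering a complete multipartite graph give rise to `x i` paths with two
vertices in part `i` and `y i` paths with one vertex there. -/
lemma exists_multiplicities_of_isometric_cover [Nontrivial ι] (hpos : ∀ i, 1 ≤ n i)
    (u v : Fin k → Σ i, Fin (n i))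
    (p : ∀ j, (completeMultipartiteGraph fun i => Fin (n i)).Walk (u j) (v j))
    (hp : ∀ j, (p j).IsIsometricPath) (hcov : ∀ w, ∃ j, w ∈ (p j).support) :
    ∃ x y : ι → ℕ, ∑ i, x i = k ∧ ∑ i, y i = k ∧ (∀ i, x i + y i ≤ k) ∧
      ∀ i, n i ≤ 2 * x i + y i := by
  classical
  have (i : ι) : Nonempty (Fin (n i)) := ⟨⟨0, hpos i⟩⟩
  choose X Y Z hXY hXZ hsupp using fun j => (hp j).exists_support_subset
  let A (i : ι) : Finset (Fin k) := Finset.univ.filter fun j => (X j).1 = i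
  let B (i : ι) : Finset (Fin k) := Finset.univ.filter fun j => (Z j).1 = i
  refine ⟨fun i => (A i).card, fun i => (B i).card, ?_, ?_, fun i => ?_, fun i => ?_⟩
  · simpa using (Finset.card_eq_sum_card_fiberwise (f := fun j => (X j).1)
      (s := Finset.univ) (t := Finset.univ) (by simp)).symm
  · simpa using (Finset.card_eq_sum_card_fiberwise (f := fun j => (Z j).1)
      (s := Finset.univ) (t := Finset.univ) (by simp)).symm
  · rw [← Finset.card_union_of_disjoint]
    · simpa using Finset.card_le_univ (A i ∪ B i)
    · rw [Finset.disjoint_left]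
      intro j hj hj'
      simp only [A, B, Finset.mem_filter, Finset.mem_univ, true_and] at hj hj'
      exact hXZ j (hj.trans hj'.symm)
  · have hsub : Finset.univ.map (Function.Embedding.sigmaMk (β := fun i => Fin (n i)) i) ⊆
        (A i).image X ∪ (A i).image Y ∪ (B i).image Z := by
      intro w hw
      obtain ⟨m, -, rfl⟩ := Finset.mem_map.1 hw
      obtain ⟨j, hj⟩ := hcov ⟨i, m⟩
      simp only [Finset.mem_union, Finset.mem_image, A, B, Finset.mem_filter, Finset.mem_univ,
        true_and, Function.Embedding.sigmaMk_apply]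
      rcases hsupp j _ hj with h | h | h
      · exact .inl (.inl ⟨j, by rw [← h], h.symm⟩)
      · exact .inl (.inr ⟨j, by rw [hXY, ← h], h.symm⟩)
      · exact .inr ⟨j, by rw [← h], h.symm⟩
    have h := Finset.card_le_card hsub
    have h₁ := Finset.card_union_le ((A i).image X ∪ (A i).image Y) ((B i).image Z)
    have h₂ := Finset.card_union_le ((A i).image X) ((A i).image Y)
    have h₃ := Finset.card_image_le (s := A i) (f := X)
    have h₄ := Finset.card_image_le (s := A i) (f := Y)
    have h₅ := Finset.card_image_le (s := B i) (f := Z)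
    simp only [Finset.card_map, Finset.card_univ, Fintype.card_fin] at h
    simp only
    omega

lemma isometricPathNumber_completeMultipartiteGraph_le (hpos : ∀ i, 1 ≤ n i) (x y : ι → ℕ)
    (hx : ∑ i, x i = k) (hy : ∑ i, y i = k) (hxy : ∀ i, x i + y i ≤ k)
    (hn : ∀ i, n i ≤ 2 * x i + y i) :
    isometricPathNumber (completeMultipartiteGraph fun i => Fin (n i)) ≤ k := by
  obtain ⟨σ, hσ, hne⟩ := exists_bijective_sigma_fst_ne hx hy hxy
  let e : Fin k ≃ Σ i, Fin (x i) := (Fintype.equivFinOfCardEq (by simp [hx])).symm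
  let c (i : ι) (m : ℕ) : Σ i, Fin (n i) := ⟨i, min m (n i - 1), by have := hpos i; omega⟩
  have hc (i : ι) (m : Fin (n i)) : c i m = ⟨i, m⟩ := by
    simp only [c]
    congr
    omega
  choose u v p hp hX hY hZ using fun a : Σ i, Fin (x i) =>
    exists_isIsometricPath_of_completeMultipartiteGraph (x := c a.1 (2 * a.2))
      (y := c a.1 (2 * a.2 + 1)) (z := c (σ a).1 (2 * x (σ a).1 + (σ a).2)) rfl (hne a)
  refine Nat.sInf_le ⟨fun j => u (e j), fun j => v (e j), fun j => p (e j), fun j => hp _, ?_⟩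
  refine fun w => e.surjective.exists.1 (?_ : ∃ a, w ∈ (p a).support)
  obtain ⟨i, m⟩ := w
  rw [← hc]
  by_cases hm : (m : ℕ) < 2 * x i
  · let a : Σ i, Fin (x i) := ⟨i, m / 2, by omega⟩
    refine ⟨a, ?_⟩
    rcases Nat.mod_two_eq_zero_or_one m with h | h
    · have h' : (m : ℕ) = 2 * a.2 := by simp only [a]; omega
      rw [h']
      exact hX a
    · have h' : (m : ℕ) = 2 * a.2 + 1 := by simp only [a]; omega
      rw [h']
      exact hY a
  · have := hn i
    obtain ⟨a, ha⟩ := hσ.2 ⟨i, m - 2 * x i, by omega⟩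
    refine ⟨a, ?_⟩
    have h := hZ a
    rw [ha] at h
    simp only at h
    rwa [Nat.add_sub_cancel' (not_lt.1 hm)] at h

lemma exists_multiplicities [Nontrivial ι] (h₁ : ∀ i, n i ≤ 2 * k) (h₂ : ∑ i, n i ≤ 3 * k)
    (h₃ : ∑ i, (n i + 1) / 2 ≤ 2 * k) :
    ∃ x y : ι → ℕ, ∑ i, x i = k ∧ ∑ i, y i = k ∧ (∀ i, x i + y i ≤ k) ∧
      ∀ i, n i ≤ 2 * x i + y i := by
  classical
  obtain ⟨s, hsum, hsk, hsn, hdef⟩ : ∃ s : ι → ℕ, ∑ i, s i = 2 * k ∧ (∀ i, s i ≤ k) ∧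
      (∀ i, n i ≤ 2 * s i) ∧ ∑ i, (n i - s i) ≤ k := by
    by_cases h : 2 * k ≤ ∑ i, min (n i) k
    · obtain ⟨s, hs, hsum⟩ := Finset.exists_sum_eq_of_sum_le_of_le_sum Finset.univ
        (fun i => (n i + 1) / 2) (fun i => min (n i) k)
        (fun i => by have := h₁ i; omega) _ h₃ h
      refine ⟨s, hsum, fun i => ?_, fun i => ?_, ?_⟩
      · have := hs i; omega
      · have := hs i; omega
      · have : ∑ i, (n i - s i) + ∑ i, s i = ∑ i, n i := by
          rw [← Finset.sum_add_distrib]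
          exact Finset.sum_congr rfl fun i _ => by have := hs i; omega
        omega
    · push Not at h
      have hcard := Fintype.one_lt_card (α := ι)
      obtain ⟨s, hs, hsum⟩ := Finset.exists_sum_eq_of_sum_le_of_le_sum Finset.univ
        (fun i => min (n i) k) (fun _ => k) (fun i => min_le_right _ _) _ h.le
        (by simpa using Nat.mul_le_mul_right k hcard)
      refine ⟨s, hsum, fun i => (hs i).2, fun i => ?_, ?_⟩
      · have := hs i; have := h₁ i; omega
      · by_cases hbig : ∃ i, k < n i
        · obtain ⟨i, hi⟩ := hbig
          have hothers (j : ι) (hj : j ≠ i) : n j - s j = 0 := by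
            have hpair := Finset.sum_le_sum_of_subset (f := fun i => min (n i) k)
              (Finset.subset_univ {i, j})
            rw [Finset.sum_pair hj.symm] at hpair
            have := hs j
            omega
          rw [Fintype.sum_eq_single i hothers]
          have := hs i; have := h₁ i; omega
        · push Not at hbig
          rw [Finset.sum_eq_zero]
          · exact Nat.zero_le k
          · intro i _
            have := hs i; have := hbig i; omega
  obtain ⟨x, hx, hxsum⟩ := Finset.exists_sum_eq_of_sum_le_of_le_sum Finset.univ
    (fun i => n i - s i) s (fun i => by have := hsn i; omega) k hdef (by omega)
  refine ⟨x, fun i => s i - x i, hxsum, ?_, fun i => ?_, fun i => ?_⟩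
  · have : ∑ i, (s i - x i) + ∑ i, x i = ∑ i, s i := by
      rw [← Finset.sum_add_distrib]
      exact Finset.sum_congr rfl fun i _ => by have := hx i; omega
    simp only
    omega
  · have := hx i; have := hsk i; simp only; omega
  · have := hx i; simp only; omega

theorem isometricPathNumber_completeMultipartiteGraph_le_iff [Nontrivial ι]
    (hpos : ∀ i, 1 ≤ n i) :
    isometricPathNumber (completeMultipartiteGraph fun i => Fin (n i)) ≤ k ↔
      (∀ i, n i ≤ 2 * k) ∧ ∑ i, n i ≤ 3 * k ∧ ∑ i, (n i + 1) / 2 ≤ 2 * k := by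
  constructor
  · intro hk
    have hmem : isometricPathNumber (completeMultipartiteGraph fun i => Fin (n i)) ∈ _ :=
      Nat.sInf_mem ?_
    · obtain ⟨u, v, p, hp, hcov⟩ := hmem
      obtain ⟨x, y, hx, hy, hxy, hn⟩ := exists_multiplicities_of_isometric_cover hpos u v p hp hcov
      refine ⟨fun i => ?_, ?_, ?_⟩
      · have := hn i; have := hxy i; omega
      · have h := Finset.sum_le_sum fun i (_ : i ∈ Finset.univ) => hn i
        rw [Finset.sum_add_distrib, ← Finset.mul_sum, hx, hy] at h
        omega
      · have h := Finset.sum_le_sum fun i (_ : i ∈ Finset.univ) =>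
          show (n i + 1) / 2 ≤ x i + y i by have := hn i; omega
        rw [Finset.sum_add_distrib, hx, hy] at h
        omega
    · refine ⟨Fintype.card (Σ i, Fin (n i)), (Fintype.equivFin _).symm, (Fintype.equivFin _).symm,
        fun _ => .nil, fun _ => ⟨.nil, by simp⟩, fun w => ⟨Fintype.equivFin _ w, by simp⟩⟩
  · rintro ⟨h₁, h₂, h₃⟩
    obtain ⟨x, y, hx, hy, hxy, hn⟩ := exists_multiplicities h₁ h₂ h₃
    exact isometricPathNumber_completeMultipartiteGraph_le hpos x y hx hy hxy hn

end Cover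

lemma two_mul_sum_add_one_div_two {ι : Type*} (s : Finset ι) (n : ι → ℕ) :
    2 * ∑ i ∈ s, (n i + 1) / 2 = ∑ i ∈ s, n i + (s.filter fun i => Odd (n i)).card := by
  rw [Finset.card_filter, Finset.mul_sum, ← Finset.sum_add_distrib]
  refine Finset.sum_congr rfl fun i _ => ?_
  simp only [Nat.odd_iff]
  split_ifs <;> omega

theorem stmt_3 (r : ℕ) (hr : 2 ≤ r) (n : Fin r → ℕ) (hpos : ∀ i, 1 ≤ n i)
    (hsorted : Antitone n) (N : ℕ) (hN : N = ∑ i, n i)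
    (α : ℕ) (hα : α = (Finset.univ.filter fun i => Odd (n i)).card) :
    (3 * n ⟨0, by omega⟩ > 2 * N →
      isometricPathNumber (completeMultipartiteGraph (fun i : Fin r => Fin (n i))) =
        (n ⟨0, by omega⟩ + 1) / 2) ∧
    (3 * α > N →
      isometricPathNumber (completeMultipartiteGraph (fun i : Fin r => Fin (n i))) =
        (N + α + 3) / 4) ∧
    (3 * α ≤ N → 3 * n ⟨0, by omega⟩ ≤ 2 * N →
      isometricPathNumber (completeMultipartiteGraph (fun i : Fin r => Fin (n i))) =
        (N + 2) / 3) := by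
  have : Nontrivial (Fin r) := Fin.nontrivial_iff_two_le.2 hr
  set i₀ : Fin r := ⟨0, by omega⟩
  have hmax (i : Fin r) : n i ≤ n i₀ := hsorted (Fin.mk_le_of_le_val (Nat.zero_le _))
  have hodd : 2 * ∑ i, (n i + 1) / 2 = N + α := by
    rw [two_mul_sum_add_one_div_two, hN, hα]
  have hα_le : n i₀ + α ≤ N + 1 := by
    have h : ∑ i ∈ Finset.univ.erase i₀, (n i + 1) / 2 ≤ ∑ i ∈ Finset.univ.erase i₀, n i :=
      Finset.sum_le_sum fun i _ => by have := hpos i; omega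
    have h₁ := Finset.add_sum_erase Finset.univ n (Finset.mem_univ i₀)
    have h₂ := Finset.add_sum_erase Finset.univ (fun i => (n i + 1) / 2) (Finset.mem_univ i₀)
    omega
  have key (k : ℕ) :
      isometricPathNumber (completeMultipartiteGraph (fun i : Fin r => Fin (n i))) ≤ k ↔
        n i₀ ≤ 2 * k ∧ N ≤ 3 * k ∧ N + α ≤ 4 * k := by
    rw [isometricPathNumber_completeMultipartiteGraph_le_iff hpos, ← hN]
    refine and_congr ⟨fun h => h i₀, fun h i => (hmax i).trans h⟩ (and_congr Iff.rfl ?_)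
    omega
  have hself := (key _).1 le_rfl
  refine ⟨fun h => ?_, fun h => ?_, fun h h' => ?_⟩ <;>
    refine le_antisymm ((key _).2 ?_) ?_ <;> omega
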